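/- Let σ be the substitution on the alphabet {1,2,3,4} defined by σ(1) = 13231, σ(2) = 13231424131, σ(3) = 42324131424, σ(4) = 42324, and let u = σ^∞(1) be its fixed point beginning with 1. Then u satisfies property R_4, i.e., every factor of u has exactly four return words. (In particular, there exists a word satisfying R_4 whose factor complexity is not 3n + 1 for all n; u has an even number of factors of every positive length.) -/

import Mathlib

variable {A : Type*}

/-- The factor of `u` of length `n` starting at position `j`. -/
def factorAt (u : ℕ → A) (j n : ℕ) : List A :=
  (List.range n).map (fun i => u (j + i))

/-- `j` is an occurrence of the finite word `w` in `u`. -/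
def OccursAt (u : ℕ → A) (w : List A) (j : ℕ) : Prop :=
  factorAt u j w.length = w

/-- `w` is a factor of the infinite word `u`. -/
def IsFactor (u : ℕ → A) (w : List A) : Prop :=
  ∃ j, OccursAt u w j

/-- `v` is a return word of `w` in `u`: the word between two successive occurrences of `w`. -/
def IsReturnWord (u : ℕ → A) (w v : List A) : Prop :=
  ∃ j k, j < k ∧ OccursAt u w j ∧ OccursAt u w k ∧
    (∀ l, j < l → l < k → ¬ OccursAt u w l) ∧ v = factorAt u j (k - j)

/-- The set `R(w)` of return words of `w` in `u`. -/
def returnWords (u : ℕ → A) (w : List A) : Set (List A) :=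
  {v | IsReturnWord u w v}

/-- Property `R_m`: every factor of `u` has exactly `m` return words. -/
def PropertyR (u : ℕ → A) (m : ℕ) : Prop :=
  ∀ w, IsFactor u w → (returnWords u w).Finite ∧ (returnWords u w).ncard = m

/-- The set of left extensions of `w`. -/
def leftExt (u : ℕ → A) (w : List A) : Set A := {a | IsFactor u (a :: w)}

/-- The set of right extensions of `w`. -/
def rightExt (u : ℕ → A) (w : List A) : Set A := {b | IsFactor u (w ++ [b])}

def LeftSpecial (u : ℕ → A) (w : List A) : Prop := 2 ≤ (leftExt u w).ncard

def RightSpecial (u : ℕ → A) (w : List A) : Prop := 2 ≤ (rightExt u w).ncard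

/-- The set of pairs `(a, b)` such that `a w b` is a factor of `u`. -/
def extPairs (u : ℕ → A) (w : List A) : Set (A × A) :=
  {p | IsFactor u (p.1 :: (w ++ [p.2]))}

/-- The bilateral order `B(w)`. -/
noncomputable def bilateralOrder (u : ℕ → A) (w : List A) : ℤ :=
  ((extPairs u w).ncard : ℤ) - (leftExt u w).ncard - (rightExt u w).ncard + 1

/-- `w` is a weak bispecial factor of `u`. -/
def WeakBispecial (u : ℕ → A) (w : List A) : Prop :=
  IsFactor u w ∧ bilateralOrder u w < 0

/-- The factor complexity of `u`. -/
noncomputable def Complexity (u : ℕ → A) (n : ℕ) : ℕ :=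
  {w : List A | w.length = n ∧ IsFactor u w}.ncard

/-- `u` is recurrent: every factor occurs at least twice. -/
def Recurrent (u : ℕ → A) : Prop :=
  ∀ w, IsFactor u w → ∃ j k, j < k ∧ OccursAt u w j ∧ OccursAt u w k

/-- `u` is uniformly recurrent. -/
def UniformlyRecurrent (u : ℕ → A) : Prop :=
  ∀ n : ℕ, ∃ N : ℕ, ∀ w, IsFactor u w → w.length = N →
    ∀ v, IsFactor u v → v.length = n → v <:+: w

def EventuallyPeriodic (u : ℕ → A) : Prop :=
  ∃ p, 0 < p ∧ ∃ N, ∀ n, N ≤ n → u (n + p) = u n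

/-- `w` is a maximal right special factor. -/
def MaximalRightSpecial (u : ℕ → A) (w : List A) : Prop :=
  IsFactor u w ∧ RightSpecial u w ∧
    ∀ v, IsFactor u v → RightSpecial u v → w <:+ v → v = w

/-- The return word `v` of `w` starts with the letter `b`. -/
def StartsWithLetter (w v : List A) (b : A) : Prop := (w ++ [b]) <+: (v ++ w)
/-- The substitution `σ : 1 ↦ 13231, 2 ↦ 13231424131, 3 ↦ 42324131424, 4 ↦ 42324`
on the alphabet `{1, 2, 3, 4}` (embedded in `ℕ`). -/
def sigma18 : ℕ → List ℕ
  | 1 => [1, 3, 2, 3, 1]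
  | 2 => [1, 3, 2, 3, 1, 4, 2, 4, 1, 3, 1]
  | 3 => [4, 2, 3, 2, 4, 1, 3, 1, 4, 2, 4]
  | 4 => [4, 2, 3, 2, 4]
  | _ => []

section Occurrences

theorem length_factorAt (u : ℕ → A) (j n : ℕ) : (factorAt u j n).length = n := by
  simp [factorAt]

theorem getElem_factorAt (u : ℕ → A) {j n t : ℕ} (h : t < (factorAt u j n).length) :
    (factorAt u j n)[t] = u (j + t) := by
  simp [factorAt]

theorem factorAt_succ (u : ℕ → A) (j n : ℕ) :
    factorAt u j (n + 1) = factorAt u j n ++ [u (j + n)] := by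
  simp [factorAt, List.range_succ]

theorem occursAt_iff {u : ℕ → A} {w : List A} {j : ℕ} :
    OccursAt u w j ↔ ∀ t (h : t < w.length), u (j + t) = w[t] := by
  unfold OccursAt
  constructor
  · intro h t ht
    rw [← getElem_factorAt u (by rwa [length_factorAt])]
    simp only [h]
  · intro h
    apply List.ext_getElem (length_factorAt _ _ _)
    intro t ht ht'
    rw [getElem_factorAt, h t ht']

theorem factorAt_eq_factorAt_iff {u : ℕ → A} {j k m n : ℕ} :
    factorAt u j m = factorAt u k n ↔ m = n ∧ ∀ t < m, u (j + t) = u (k + t) := by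
  constructor
  · intro h
    have hmn : m = n := by simpa [length_factorAt] using congrArg List.length h
    subst hmn
    refine ⟨rfl, fun t ht => ?_⟩
    rw [← getElem_factorAt u (n := m) (by rwa [length_factorAt]),
      ← getElem_factorAt u (j := k) (n := m) (by rwa [length_factorAt])]
    simp only [h]
  · rintro ⟨rfl, h⟩
    apply List.ext_getElem (by simp only [length_factorAt])
    intro t ht _
    rw [length_factorAt] at ht
    rw [getElem_factorAt, getElem_factorAt, h t ht]

theorem occursAt_factorAt_iff {u : ℕ → A} {i j n : ℕ} :
    OccursAt u (factorAt u i n) j ↔ ∀ t < n, u (i + t) = u (j + t) := by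
  unfold OccursAt
  rw [length_factorAt, factorAt_eq_factorAt_iff]
  simp only [true_and]
  exact ⟨fun h t ht => (h t ht).symm, fun h t ht => (h t ht).symm⟩

theorem occursAt_append {u : ℕ → A} {v w : List A} {j : ℕ} :
    OccursAt u (v ++ w) j ↔ OccursAt u v j ∧ OccursAt u w (j + v.length) := by
  induction v generalizing j with
  | nil => simp [OccursAt, factorAt]
  | cons a v ih =>
    have hcons : ∀ (s : List A) (j : ℕ), OccursAt u (a :: s) j ↔
        u j = a ∧ OccursAt u s (j + 1) := by
      intro s j
      simp only [OccursAt, factorAt, List.length_cons, List.range_succ_eq_map, List.map_cons,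
        List.map_map, List.cons.injEq, add_zero]
      refine and_congr_right fun _ => ?_
      have : ((fun i => u (j + i)) ∘ Nat.succ) = fun i => u (j + 1 + i) := by
        funext i
        simp [Nat.add_assoc, Nat.add_comm 1]
      rw [this]
    rw [List.cons_append, hcons, hcons, ih, and_assoc, List.length_cons, Nat.add_assoc,
      Nat.add_comm 1]

theorem occursAt_singleton {u : ℕ → A} {a : A} {j : ℕ} : OccursAt u [a] j ↔ u j = a := by
  simp [OccursAt, factorAt]

theorem OccursAt.of_prefix {u : ℕ → A} {v w : List A} {j : ℕ} (h : OccursAt u w j)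
    (hv : v <+: w) : OccursAt u v j := by
  obtain ⟨s, rfl⟩ := hv
  exact (occursAt_append.1 h).1

theorem OccursAt.drop {u : ℕ → A} {w : List A} {j e : ℕ} (h : OccursAt u w j)
    (he : e ≤ w.length) : OccursAt u (w.drop e) (j + e) := by
  rw [← List.take_append_drop e w, occursAt_append] at h
  simpa [he] using h.2

theorem OccursAt.prefix_of_length_le {u : ℕ → A} {v w : List A} {j : ℕ} (hv : OccursAt u v j)
    (hw : OccursAt u w j) (h : v.length ≤ w.length) : v <+: w := by
  rw [List.prefix_iff_eq_take]
  apply List.ext_getElem (by simpa using h)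
  intro t ht _
  rw [List.getElem_take, ← occursAt_iff.1 hv t ht, ← occursAt_iff.1 hw]

theorem OccursAt.factorAt_eq_take {u : ℕ → A} {w : List A} {j n : ℕ} (h : OccursAt u w j)
    (hn : n ≤ w.length) : factorAt u j n = w.take n := by
  have := h.of_prefix (List.take_prefix n w)
  rwa [OccursAt, List.length_take_of_le hn] at this

theorem OccursAt.factorAt_eq_take_drop {u : ℕ → A} {w : List A} {j e n : ℕ} (h : OccursAt u w j)
    (hn : e + n ≤ w.length) : factorAt u (j + e) n = (w.drop e).take n :=
  (h.drop (by omega)).factorAt_eq_take (by rw [List.length_drop]; omega)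

end Occurrences

theorem exists_le_lt_succ {f : ℕ → ℕ} {x n : ℕ} (h₀ : f 0 ≤ x) (hn : x < f n) :
    ∃ i < n, f i ≤ x ∧ x < f (i + 1) := by
  induction n with
  | zero => omega
  | succ n ih =>
    by_cases h : x < f n
    · obtain ⟨i, hi, hx⟩ := ih h
      exact ⟨i, by omega, hx⟩
    · exact ⟨n, by omega, by omega, hn⟩

section FixedPoint

/-- `u` begins with `1` and is fixed by `sigma18`. -/
def IsFixedPoint (u : ℕ → ℕ) : Prop :=
  u 0 = 1 ∧ ∀ k, OccursAt u ((factorAt u 0 k).flatMap sigma18) 0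

/-- The image of a word under `sigma18`. -/
def image (w : List ℕ) : List ℕ := w.flatMap sigma18

/-- The position at which the image of the `k`-th letter of `u` starts. -/
def blockPos (u : ℕ → ℕ) : ℕ → ℕ
  | 0 => 0
  | k + 1 => blockPos u k + (sigma18 (u k)).length

/-- The factors of length four of the fixed point. -/
def quads : List (List ℕ) :=
  [[1, 3, 2, 3], [3, 2, 3, 1], [2, 3, 1, 4], [3, 1, 4, 2], [1, 4, 2, 3], [4, 2, 3, 2], [2, 3, 2, 4],
   [3, 2, 4, 1], [2, 4, 1, 3], [4, 1, 3, 1], [1, 3, 1, 4], [1, 4, 2, 4], [4, 2, 4, 1], [4, 1, 3, 2]]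

variable {u : ℕ → ℕ}

theorem length_image_factorAt_zero (u : ℕ → ℕ) (k : ℕ) :
    (image (factorAt u 0 k)).length = blockPos u k := by
  induction k with
  | zero => simp [factorAt, image, blockPos]
  | succ k ih =>
    rw [factorAt_succ, image, List.flatMap_append, List.length_append]
    change (image (factorAt u 0 k)).length + _ = _
    simp [ih, blockPos]

theorem IsFixedPoint.occursAt_block (hu : IsFixedPoint u) (k : ℕ) :
    OccursAt u (sigma18 (u k)) (blockPos u k) := by
  have h := hu.2 (k + 1)
  rw [factorAt_succ, List.flatMap_append, occursAt_append] at h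
  have h' := h.2
  change OccursAt u _ (0 + (image (factorAt u 0 k)).length) at h'
  simpa [length_image_factorAt_zero] using h'

theorem IsFixedPoint.occursAt_image (hu : IsFixedPoint u) {w : List ℕ} {i : ℕ}
    (h : OccursAt u w i) :
    OccursAt u (image w) (blockPos u i) ∧
      blockPos u (i + w.length) = blockPos u i + (image w).length := by
  induction w generalizing i with
  | nil => simp [image, OccursAt, factorAt]
  | cons a w ih =>
    rw [← List.singleton_append, occursAt_append, occursAt_singleton] at h
    obtain ⟨rfl, h⟩ := h
    have ih := ih (i := i + 1) h
    have hb : blockPos u (i + 1) = blockPos u i + (sigma18 (u i)).length := rfl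
    have hi : image (u i :: w) = sigma18 (u i) ++ image w := rfl
    rw [hi, occursAt_append, ← hb]
    refine ⟨⟨hu.occursAt_block i, ih.1⟩, ?_⟩
    rw [List.length_cons, List.length_append, Nat.add_comm w.length, ← Nat.add_assoc, ih.2, hb,
      Nat.add_assoc]

theorem factorAt_four (u : ℕ → ℕ) (i : ℕ) :
    factorAt u i 4 = [u i, u (i + 1), u (i + 2), u (i + 3)] := rfl

theorem IsFixedPoint.quad_mem (hu : IsFixedPoint u) (i : ℕ) : factorAt u i 4 ∈ quads := by
  induction i using Nat.strong_induction_on with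
  | _ i ih =>
    rcases Nat.eq_zero_or_pos i with rfl | hi
    · have h : OccursAt u [1, 3, 2, 3, 1] 0 := by
        simpa [hu.1, sigma18, blockPos] using hu.occursAt_block 0
      rw [h.factorAt_eq_take (by simp)]
      decide
    · have hlen : ∀ v ∈ quads, 5 ≤ (sigma18 (v.headD 0)).length := by decide
      have hpos : ∀ n ≤ i, 5 * n ≤ blockPos u n := by
        intro n
        induction n with
        | zero => simp
        | succ n ihn =>
          intro hn
          have h1 := ihn (by omega)
          have h2 : 5 ≤ (sigma18 (u n)).length := hlen _ (ih n hn)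
          simp only [blockPos]
          omega
      obtain ⟨k, hk, hle, hlt⟩ := exists_le_lt_succ (f := blockPos u) (x := i) (n := i)
        (by simp [blockPos]) (by have := hpos i le_rfl; omega)
      obtain ⟨e, rfl⟩ := Nat.exists_eq_add_of_le hle
      have hocc := (hu.occursAt_image (w := factorAt u k 4) (i := k)
        (by rw [OccursAt, length_factorAt])).1
      have key : ∀ v ∈ quads, ∀ e < (sigma18 (v.headD 0)).length,
          e + 4 ≤ (image v).length ∧ ((image v).drop e).take 4 ∈ quads := by decide
      have hkey := key _ (ih k hk) e (by
        simp only [blockPos] at hlt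
        change e < (sigma18 (u k)).length
        omega)
      rw [hocc.factorAt_eq_take_drop hkey.1]
      exact hkey.2

theorem IsFixedPoint.letter_mem (hu : IsFixedPoint u) (i : ℕ) : u i ∈ [1, 2, 3, 4] := by
  have h : ∀ v ∈ quads, v.headD 0 ∈ [1, 2, 3, 4] := by decide
  exact h _ (hu.quad_mem i)

theorem IsFixedPoint.five_le_length (hu : IsFixedPoint u) (i : ℕ) :
    5 ≤ (sigma18 (u i)).length := by
  have h : ∀ a ∈ [1, 2, 3, 4], 5 ≤ (sigma18 a).length := by decide
  exact h _ (hu.letter_mem i)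

theorem IsFixedPoint.five_mul_le_blockPos (hu : IsFixedPoint u) (i n : ℕ) :
    blockPos u i + 5 * n ≤ blockPos u (i + n) := by
  induction n with
  | zero => simp
  | succ n ih =>
    have := hu.five_le_length (i + n)
    have hb : blockPos u (i + (n + 1)) = blockPos u (i + n) + (sigma18 (u (i + n))).length := rfl
    omega

theorem IsFixedPoint.blockPos_strictMono (hu : IsFixedPoint u) : StrictMono (blockPos u) :=
  strictMono_nat_of_lt_succ fun i => by have := hu.five_mul_le_blockPos i 1; omega

theorem IsFixedPoint.exists_block (hu : IsFixedPoint u) (x : ℕ) :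
    ∃ i, blockPos u i ≤ x ∧ x < blockPos u (i + 1) := by
  obtain ⟨i, -, h⟩ := exists_le_lt_succ (f := blockPos u) (x := x) (n := x + 1)
    (by simp [blockPos]) (by have := hu.five_mul_le_blockPos 0 (x + 1); simp at this; omega)
  exact ⟨i, h⟩

theorem IsFixedPoint.exists_pos_prefix_recurs (hu : IsFixedPoint u) (n : ℕ) :
    ∃ q, 0 < q ∧ ∀ t < n, u t = u (q + t) := by
  have h₄ : OccursAt u [1, 3, 2, 3, 1] 0 := by
    simpa [hu.1, sigma18, blockPos] using hu.occursAt_block 0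
  suffices h : ∀ n, ∃ q, 0 < q ∧ OccursAt u (factorAt u 0 (n + 1)) q by
    obtain ⟨q, hq, h⟩ := h n
    refine ⟨q, hq, fun t ht => ?_⟩
    simpa using occursAt_factorAt_iff.1 h t (by omega)
  intro n
  induction n with
  | zero =>
    refine ⟨4, by norm_num, occursAt_factorAt_iff.2 fun t ht => ?_⟩
    obtain rfl : t = 0 := by omega
    simpa [hu.1] using (occursAt_iff.1 h₄ 4 (by simp)).symm
  | succ n ih =>
    obtain ⟨q, hq, h⟩ := ih
    have h₀ := hu.occursAt_image (w := factorAt u 0 (n + 1)) (i := 0)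
      (by rw [OccursAt, length_factorAt])
    have hlen := hu.five_mul_le_blockPos 0 (n + 1)
    rw [zero_add, ← length_image_factorAt_zero u (n + 1)] at hlen
    have hq' := hu.five_mul_le_blockPos 0 q
    rw [zero_add] at hq'
    refine ⟨blockPos u q, by omega, ?_⟩
    rw [show blockPos u 0 = 0 from rfl] at h₀
    rw [h₀.1.factorAt_eq_take (by omega)]
    exact (hu.occursAt_image h).1.of_prefix (List.take_prefix _ _)

theorem IsFixedPoint.apply_blockPos_add (hu : IsFixedPoint u) (i : ℕ) {e : ℕ}
    (he : e < (sigma18 (u i)).length + 15) :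
    u (blockPos u i + e) = (image (factorAt u i 4)).getD e 0 := by
  have h := (hu.occursAt_image (w := factorAt u i 4) (i := i) (by rw [OccursAt, length_factorAt])).1
  have hlen : ∀ v ∈ quads, (sigma18 (v.headD 0)).length + 15 ≤ (image v).length := by decide
  have := hlen _ (hu.quad_mem i)
  rw [factorAt_four, List.headD_cons, ← factorAt_four] at this
  have he' : e < (image (factorAt u i 4)).length := by omega
  rw [occursAt_iff.1 h e he', List.getD_eq_getElem _ _ he']

theorem IsFixedPoint.length_le (hu : IsFixedPoint u) (i : ℕ) :
    (sigma18 (u i)).length ≤ 11 := by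
  have h : ∀ a ∈ [1, 2, 3, 4], (sigma18 a).length ≤ 11 := by decide
  exact h _ (hu.letter_mem i)

/-- The three-letter words which mark the starting positions of the blocks. -/
def IsMark (x y z : ℕ) : Prop := x = 1 ∧ y = 3 ∧ z = 2 ∨ x = 4 ∧ y = 2 ∧ z = 3

instance (x y z : ℕ) : Decidable (IsMark x y z) := by
  unfold IsMark
  infer_instance

theorem IsFixedPoint.isMark_iff (hu : IsFixedPoint u) (x : ℕ) :
    IsMark (u x) (u (x + 1)) (u (x + 2)) ↔ ∃ i, x = blockPos u i := by
  obtain ⟨i, hle, hlt⟩ := hu.exists_block x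
  obtain ⟨e, rfl⟩ := Nat.exists_eq_add_of_le hle
  have he : e < (sigma18 (u i)).length := by
    simp only [blockPos] at hlt
    omega
  have key : ∀ v ∈ quads, ∀ e < (sigma18 (v.headD 0)).length,
      (IsMark ((image v).getD e 0) ((image v).getD (e + 1) 0) ((image v).getD (e + 2) 0) ↔
        e = 0) := by decide
  rw [Nat.add_assoc, Nat.add_assoc, hu.apply_blockPos_add i (by omega),
    hu.apply_blockPos_add i (by omega), hu.apply_blockPos_add i (by omega),
    key _ (hu.quad_mem i) e he]
  constructor
  · rintro rfl
    exact ⟨i, rfl⟩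
  · rintro ⟨k, hk⟩
    have h1 : i ≤ k := hu.blockPos_strictMono.le_iff_le.1 (by omega)
    have h2 : k < i + 1 := hu.blockPos_strictMono.lt_iff_lt.1 (by omega)
    obtain rfl : k = i := by omega
    omega

theorem IsFixedPoint.letter_eq_of_right (hu : IsFixedPoint u) {i k : ℕ}
    (h : u (blockPos u i + 7) = u (blockPos u k + 7)) : u i = u k := by
  have key : ∀ v ∈ quads, ∀ w ∈ quads, (image v).getD 7 0 = (image w).getD 7 0 →
      v.headD 0 = w.headD 0 := by decide +kernel
  rw [hu.apply_blockPos_add i (by omega), hu.apply_blockPos_add k (by omega)] at h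
  exact key _ (hu.quad_mem i) _ (hu.quad_mem k) h

theorem IsFixedPoint.letter_eq_of_left (hu : IsFixedPoint u) {i k : ℕ}
    (h : u (blockPos u (i + 1) - 3) = u (blockPos u (k + 1) - 3)) : u i = u k := by
  have key : ∀ v ∈ quads, ∀ w ∈ quads,
      (image v).getD ((sigma18 (v.headD 0)).length - 3) 0 =
        (image w).getD ((sigma18 (w.headD 0)).length - 3) 0 →
      v.headD 0 = w.headD 0 := by decide +kernel
  have hi := hu.five_le_length i
  have hk := hu.five_le_length k
  simp only [blockPos] at h
  rw [Nat.add_sub_assoc (by omega), Nat.add_sub_assoc (by omega),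
    hu.apply_blockPos_add i (by omega), hu.apply_blockPos_add k (by omega)] at h
  exact key _ (hu.quad_mem i) _ (hu.quad_mem k) h

theorem IsFixedPoint.eq_right_of_letter_eq (hu : IsFixedPoint u) {i k : ℕ} (h : u i = u k) {e : ℕ}
    (he : e < 7) : u (blockPos u (i + 1) + e) = u (blockPos u (k + 1) + e) := by
  have key : ∀ v ∈ quads, ∀ w ∈ quads, v.headD 0 = w.headD 0 → ∀ e < 7,
      (image v).getD ((sigma18 (v.headD 0)).length + e) 0 =
        (image w).getD ((sigma18 (w.headD 0)).length + e) 0 := by decide +kernel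
  simp only [blockPos, Nat.add_assoc]
  rw [hu.apply_blockPos_add i (by omega), hu.apply_blockPos_add k (by omega)]
  exact key _ (hu.quad_mem i) _ (hu.quad_mem k) h e he

theorem IsFixedPoint.eq_left_of_letter_eq (hu : IsFixedPoint u) {i k : ℕ}
    (h : u (i + 1) = u (k + 1)) {e : ℕ} (he₀ : 0 < e) (he : e ≤ 2) :
    u (blockPos u (i + 1) - e) = u (blockPos u (k + 1) - e) := by
  have key : ∀ v ∈ quads, ∀ w ∈ quads, v.getD 1 0 = w.getD 1 0 → ∀ e ≤ 2, 0 < e →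
      (image v).getD ((sigma18 (v.headD 0)).length - e) 0 =
        (image w).getD ((sigma18 (w.headD 0)).length - e) 0 := by decide +kernel
  have hi := hu.five_le_length i
  have hk := hu.five_le_length k
  simp only [blockPos]
  rw [Nat.add_sub_assoc (by omega), Nat.add_sub_assoc (by omega),
    hu.apply_blockPos_add i (by omega), hu.apply_blockPos_add k (by omega)]
  exact key _ (hu.quad_mem i) _ (hu.quad_mem k) h e he he₀

theorem IsFixedPoint.eq_block_of_letter_eq (hu : IsFixedPoint u) {i k : ℕ} (h : u i = u k) {e : ℕ}
    (he : e < (sigma18 (u i)).length) : u (blockPos u i + e) = u (blockPos u k + e) := by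
  have hk := occursAt_iff.1 (hu.occursAt_block k) e (by rwa [← h])
  rw [occursAt_iff.1 (hu.occursAt_block i) e he, hk]
  simp only [h]

theorem blockPos_add_of_eq {i k m t : ℕ} (h : ∀ t < m, u (i + t) = u (k + t)) (ht : t ≤ m) :
    blockPos u (i + t) + blockPos u k = blockPos u (k + t) + blockPos u i := by
  induction t with
  | zero => exact Nat.add_comm _ _
  | succ t ih =>
    have hi : blockPos u (i + (t + 1)) = blockPos u (i + t) + (sigma18 (u (i + t))).length := rfl
    have hk : blockPos u (k + (t + 1)) = blockPos u (k + t) + (sigma18 (u (k + t))).length := rfl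
    rw [h t (by omega)] at hi
    have := ih (by omega)
    omega

/-- If `u` has the same `m ≥ 1` letters from `i` and from `k` on, then it has the same letters
from two positions before the corresponding blocks until seven positions after them. -/
theorem IsFixedPoint.eq_of_blocks_eq (hu : IsFixedPoint u) {i k m x y : ℕ} (hm : 1 ≤ m)
    (h : ∀ t < m, u (i + t) = u (k + t)) (hx : blockPos u i ≤ x + 2)
    (hx' : x < blockPos u (i + m) + 7) (hy : y + blockPos u i = x + blockPos u k) :
    u x = u y := by
  have h₀ := h 0 (by omega)
  rw [Nat.add_zero, Nat.add_zero] at h₀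
  rcases lt_or_ge x (blockPos u i) with hxi | hxi
  · cases i with
    | zero => simp [blockPos] at hxi
    | succ i =>
      cases k with
      | zero =>
        rw [show blockPos u 0 = 0 from rfl] at hy
        omega
      | succ k =>
        have := hu.eq_left_of_letter_eq h₀ (e := blockPos u (i + 1) - x) (by omega) (by omega)
        rwa [show blockPos u (i + 1) - (blockPos u (i + 1) - x) = x by omega,
          show blockPos u (k + 1) - (blockPos u (i + 1) - x) = y by omega] at this
  · rcases lt_or_ge x (blockPos u (i + m)) with hxm | hxm
    · obtain ⟨t, ht, hle, hlt⟩ := exists_le_lt_succ (f := fun t => blockPos u (i + t)) (x := x)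
        (n := m) hxi hxm
      change x < blockPos u (i + t) + (sigma18 (u (i + t))).length at hlt
      have hb := blockPos_add_of_eq h (t := t) (by omega)
      have := hu.eq_block_of_letter_eq (h t ht) (e := x - blockPos u (i + t)) (by omega)
      rwa [show blockPos u (i + t) + (x - blockPos u (i + t)) = x by omega,
        show blockPos u (k + t) + (x - blockPos u (i + t)) = y by omega] at this
    · obtain ⟨m, rfl⟩ := Nat.exists_eq_add_of_le' hm
      have hb := blockPos_add_of_eq h (t := m + 1) le_rfl
      simp only [← Nat.add_assoc] at hb hxm hx'
      have := hu.eq_right_of_letter_eq (h m (by omega)) (e := x - blockPos u (i + m + 1)) (by omega)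
      rwa [show blockPos u (i + m + 1) + (x - blockPos u (i + m + 1)) = x by omega,
        show blockPos u (k + m + 1) + (x - blockPos u (i + m + 1)) = y by omega] at this

/-- Recognizability: a long enough word determines the blocks which it meets. -/
theorem IsFixedPoint.exists_blocks_eq (hu : IsFixedPoint u) {i d j j' n m : ℕ} (hn : 13 ≤ n)
    (h : ∀ t < n, u (j + t) = u (j' + t)) (hj : j + 2 = blockPos u i + d)
    (hd : d < (sigma18 (u i)).length) (hm : 1 ≤ m) (hmn : blockPos u (i + m - 1) + 8 ≤ j + n) :
    ∃ k, j' + 2 = blockPos u k + d ∧ ∀ t < m, u (i + t) = u (k + t) := by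
  have hwin : ∀ x x', j ≤ x → x < j + n → x' + j = x + j' → u x = u x' := by
    intro x x' h1 h2 h3
    have := h (x - j) (by omega)
    rwa [show j + (x - j) = x by omega, show j' + (x - j) = x' by omega] at this
  have hmark : ∀ k x', j ≤ blockPos u k → blockPos u k + 2 < j + n →
      x' + j = blockPos u k + j' → ∃ k', x' = blockPos u k' := by
    intro k x' h1 h2 h3
    rw [← hu.isMark_iff, ← hwin (blockPos u k) x' h1 (by omega) h3,
      ← hwin (blockPos u k + 1) (x' + 1) (by omega) (by omega) (by omega),
      ← hwin (blockPos u k + 2) (x' + 2) (by omega) (by omega) (by omega), hu.isMark_iff]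
    exact ⟨k, rfl⟩
  have hmono : blockPos u i ≤ blockPos u (i + m - 1) :=
    hu.blockPos_strictMono.monotone (by omega)
  obtain ⟨k, hk, h₀⟩ : ∃ k, j' + 2 = blockPos u k + d ∧ u i = u k := by
    rcases le_or_gt d 2 with hd2 | hd2
    · obtain ⟨k, hk⟩ := hmark i (j' + 2 - d) (by omega) (by omega) (by omega)
      exact ⟨k, by omega, hu.letter_eq_of_right (hwin _ _ (by omega) (by omega) (by omega))⟩
    · have hb : blockPos u (i + 1) = blockPos u i + (sigma18 (u i)).length := rfl
      have hle := hu.length_le i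
      obtain ⟨k, hk⟩ := hmark (i + 1) (j' + 2 + (sigma18 (u i)).length - d) (by omega) (by omega)
        (by omega)
      cases k with
      | zero =>
        rw [show blockPos u 0 = 0 from rfl] at hk
        omega
      | succ k =>
        have h₀ : u i = u k :=
          hu.letter_eq_of_left (hwin _ _ (by omega) (by omega) (by omega))
        have hb' : blockPos u (k + 1) = blockPos u k + (sigma18 (u k)).length := rfl
        rw [← h₀] at hb'
        exact ⟨k, by omega, h₀⟩
  refine ⟨k, hk, ?_⟩
  suffices hs : ∀ s ≤ m, ∀ t < s, u (i + t) = u (k + t) from hs m le_rfl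
  intro s
  induction s with
  | zero => simp
  | succ s ih =>
    intro hs t ht
    have ih := ih (by omega)
    rcases Nat.lt_succ_iff_lt_or_eq.1 ht with ht | rfl
    · exact ih t ht
    · rcases Nat.eq_zero_or_pos t with rfl | htpos
      · exact h₀
      · have hb := blockPos_add_of_eq ih (t := t) le_rfl
        have h1 : blockPos u (i + 1) ≤ blockPos u (i + t) :=
          hu.blockPos_strictMono.monotone (by omega)
        have h2 : blockPos u (i + t) ≤ blockPos u (i + m - 1) :=
          hu.blockPos_strictMono.monotone (by omega)
        have h3 : blockPos u (i + 1) = blockPos u i + (sigma18 (u i)).length := rfl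
        exact hu.letter_eq_of_right (hwin _ _ (by omega) (by omega) (by omega))

end FixedPoint

/-- `j` and `k` are successive occurrences of `w` in `u`. -/
def Successive {A : Type*} (u : ℕ → A) (w : List A) (j k : ℕ) : Prop :=
  j < k ∧ OccursAt u w j ∧ OccursAt u w k ∧ ∀ l, j < l → l < k → ¬ OccursAt u w l

theorem mem_returnWords_iff {A : Type*} {u : ℕ → A} {w v : List A} :
    v ∈ returnWords u w ↔ ∃ j k, Successive u w j k ∧ v = factorAt u j (k - j) := by
  constructor
  · rintro ⟨j, k, h1, h2, h3, h4, h5⟩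
    exact ⟨j, k, ⟨h1, h2, h3, h4⟩, h5⟩
  · rintro ⟨j, k, ⟨h1, h2, h3, h4⟩, h5⟩
    exact ⟨j, k, h1, h2, h3, h4, h5⟩

theorem Successive.eq_of_le {A : Type*} {u : ℕ → A} {w : List A} {j k k' : ℕ}
    (h : Successive u w j k) (hjk' : j < k') (hk' : OccursAt u w k') : k ≤ k' :=
  not_lt.1 fun hlt => h.2.2.2 k' hjk' hlt hk'

theorem Successive.shift {A : Type*} {u : ℕ → A} {w : List A} {j k q : ℕ}
    (h : Successive u w j k) (hq : ∀ t < k + w.length, u t = u (q + t)) :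
    Successive u w (q + j) (q + k) := by
  have hocc : ∀ l ≤ k, OccursAt u w l ↔ OccursAt u w (q + l) := by
    intro l hl
    simp only [occursAt_iff]
    refine forall₂_congr fun t ht => ?_
    rw [hq (l + t) (by omega), Nat.add_assoc]
  obtain ⟨hjk, hj, hk, hl⟩ := h
  refine ⟨by omega, (hocc j hjk.le).1 hj, (hocc k le_rfl).1 hk, fun l h1 h2 h3 => ?_⟩
  obtain ⟨l, rfl⟩ := Nat.exists_eq_add_of_le (show q ≤ l by omega)
  exact hl l (by omega) (by omega) ((hocc l (by omega)).2 h3)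

theorem encard_image_eq_of_eq_iff {α β γ : Type*} [Nonempty α] {T : Set α} {g : α → β} {h : α → γ}
    (H : ∀ p ∈ T, ∀ q ∈ T, g p = g q ↔ h p = h q) : (g '' T).encard = (h '' T).encard := by
  have hmem : ∀ p ∈ T, Function.invFunOn g T (g p) ∈ T := fun p hp =>
    Function.invFunOn_mem ⟨p, hp, rfl⟩
  have heq : ∀ p ∈ T, g (Function.invFunOn g T (g p)) = g p := fun p hp =>
    Function.invFunOn_eq ⟨p, hp, rfl⟩
  have himage : h '' T = (fun b => h (Function.invFunOn g T b)) '' (g '' T) := by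
    rw [Set.image_image]
    exact Set.image_congr fun p hp => ((H _ (hmem p hp) _ hp).1 (heq p hp)).symm
  have hinj : Set.InjOn (fun b => h (Function.invFunOn g T b)) (g '' T) := by
    rintro _ ⟨p, hp, rfl⟩ _ ⟨q, hq, rfl⟩ hpq
    rw [← heq p hp, ← heq q hq]
    exact (H _ (hmem p hp) _ (hmem q hq)).2 hpq
  rw [himage, hinj.encard_image]

section Desubstitution

variable {u : ℕ → ℕ} {d i m j n : ℕ}

theorem IsFixedPoint.exists_desubstitution (hu : IsFixedPoint u) (j : ℕ) (hn : 13 ≤ n) :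
    ∃ i m d, 1 ≤ m ∧ m < n ∧ j + 2 = blockPos u i + d ∧ d < (sigma18 (u i)).length ∧
      blockPos u (i + m - 1) + 8 ≤ j + n ∧ j + n ≤ blockPos u (i + m) + 7 := by
  obtain ⟨i, hle, hlt⟩ := hu.exists_block (j + 2)
  have hi : blockPos u (i + 1) = blockPos u i + (sigma18 (u i)).length := rfl
  have hex : ∃ m, j + n ≤ blockPos u (i + m) + 7 :=
    ⟨j + n, by have := hu.five_mul_le_blockPos i (j + n); omega⟩
  classical
  obtain ⟨m, hm⟩ : ∃ m, Nat.find hex = m := ⟨_, rfl⟩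
  have hspec := Nat.find_spec hex
  have hmin := fun k => Nat.find_min hex (m := k)
  rw [hm] at hspec hmin
  cases m with
  | zero =>
    simp only [Nat.add_zero] at hspec
    omega
  | succ m =>
    have h1 := hmin m (by omega)
    have h2 := hu.five_mul_le_blockPos i m
    have h3 := hu.length_le i
    refine ⟨i, m + 1, j + 2 - blockPos u i, by omega, by omega, by omega, by omega, ?_, hspec⟩
    rw [← Nat.add_assoc, Nat.add_sub_cancel]
    omega

theorem IsFixedPoint.encard_returnWords_eq_of_desubstitution (hu : IsFixedPoint u) (hn : 13 ≤ n)
    (hm : 1 ≤ m) (hj : j + 2 = blockPos u i + d) (hd : d < (sigma18 (u i)).length)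
    (hmn : blockPos u (i + m - 1) + 8 ≤ j + n) (hnm : j + n ≤ blockPos u (i + m) + 7) :
    (returnWords u (factorAt u i m)).encard = (returnWords u (factorAt u j n)).encard := by
  have hlift : ∀ l k, OccursAt u (factorAt u i m) k → l + 2 = blockPos u k + d →
      OccursAt u (factorAt u j n) l := by
    intro l k hk hl
    rw [occursAt_factorAt_iff] at hk ⊢
    intro t ht
    exact hu.eq_of_blocks_eq hm hk (by omega) (by omega) (by omega)
  have hdesc : ∀ l, OccursAt u (factorAt u j n) l →
      ∃ k, OccursAt u (factorAt u i m) k ∧ l + 2 = blockPos u k + d := by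
    intro l hl
    obtain ⟨k, hk, h⟩ := hu.exists_blocks_eq hn (occursAt_factorAt_iff.1 hl) hj hd hm hmn
    exact ⟨k, occursAt_factorAt_iff.2 h, hk⟩
  have hmono := hu.blockPos_strictMono
  have hsucc : ∀ k k' l l', Successive u (factorAt u i m) k k' → l + 2 = blockPos u k + d →
      l' + 2 = blockPos u k' + d → Successive u (factorAt u j n) l l' := by
    rintro k k' l l' ⟨hlt, hk, hk', hno⟩ hl hl'
    have := hmono hlt
    refine ⟨by omega, hlift l k hk hl, hlift l' k' hk' hl', fun x h1 h2 h3 => ?_⟩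
    obtain ⟨y, hy, hxy⟩ := hdesc x h3
    exact hno y (hmono.lt_iff_lt.1 (by omega)) (hmono.lt_iff_lt.1 (by omega)) hy
  let T : Set (ℕ × ℕ) := {p | Successive u (factorAt u i m) p.1 p.2 ∧ 2 ≤ blockPos u p.1 + d}
  have hv : returnWords u (factorAt u i m) =
      (fun p : ℕ × ℕ => factorAt u p.1 (p.2 - p.1)) '' T := by
    ext r
    rw [mem_returnWords_iff]
    constructor
    · rintro ⟨k, k', h, rfl⟩
      obtain ⟨q, hq, hrec⟩ := hu.exists_pos_prefix_recurs (k' + m)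
      have h' := h.shift (q := q) (by rwa [length_factorAt])
      refine ⟨(q + k, q + k'), ⟨h', ?_⟩, ?_⟩
      · have := hu.five_mul_le_blockPos 0 (q + k)
        rw [zero_add] at this
        change 2 ≤ blockPos u (q + k) + d
        omega
      · have hlt := h.1
        refine factorAt_eq_factorAt_iff.2 ⟨by simp only; omega, fun t ht => ?_⟩
        simp only at ht ⊢
        rw [hrec (k + t) (by omega), Nat.add_assoc]
    · rintro ⟨⟨k, k'⟩, ⟨h, -⟩, rfl⟩
      exact ⟨k, k', h, rfl⟩
  have hw : returnWords u (factorAt u j n) = (fun p : ℕ × ℕ =>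
      factorAt u (blockPos u p.1 + d - 2) (blockPos u p.2 - blockPos u p.1)) '' T := by
    ext r
    rw [mem_returnWords_iff]
    constructor
    · rintro ⟨l, l', ⟨hlt, hl, hl', hno⟩, rfl⟩
      obtain ⟨k, hk, hlk⟩ := hdesc l hl
      obtain ⟨k', hk', hlk'⟩ := hdesc l' hl'
      have hkk' : k < k' := hmono.lt_iff_lt.1 (by omega)
      refine ⟨(k, k'), ⟨⟨hkk', hk, hk', fun y h1 h2 h3 => ?_⟩, ?_⟩, ?_⟩
      · have h1 : blockPos u k < blockPos u y := hmono h1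
        have h2 : blockPos u y < blockPos u k' := hmono h2
        exact hno (blockPos u y + d - 2) (by omega) (by omega) (hlift _ y h3 (by omega))
      · change 2 ≤ blockPos u k + d
        omega
      · simp only
        congr 1 <;> omega
    · rintro ⟨⟨k, k'⟩, ⟨h, h2⟩, rfl⟩
      simp only at h h2 ⊢
      have := hmono h.1
      exact ⟨_, _, hsucc k k' (blockPos u k + d - 2) (blockPos u k' + d - 2) h (by omega)
        (by omega), by congr 1; omega⟩
  rw [hv, hw]
  refine encard_image_eq_of_eq_iff ?_
  rintro ⟨k, k'⟩ ⟨h, h2⟩ ⟨x, x'⟩ ⟨hx, hx2⟩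
  simp only [factorAt_eq_factorAt_iff] at h h2 hx hx2 ⊢
  have hkm := occursAt_factorAt_iff.1 h.2.1
  have hkm' := occursAt_factorAt_iff.1 h.2.2.1
  have hxm' := occursAt_factorAt_iff.1 hx.2.2.1
  have hlt := h.1
  have hlt' := hx.1
  have hblt := hmono hlt
  have hblt' := hmono hlt'
  constructor
  · rintro ⟨hlen, heq⟩
    have heq' : ∀ t < k' - k + m, u (k + t) = u (x + t) := by
      intro t ht
      rcases lt_or_ge t (k' - k) with h1 | h1
      · exact heq t h1
      · have e1 := hkm' (t - (k' - k)) (by omega)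
        have e2 := hxm' (t - (k' - k)) (by omega)
        rw [e1] at e2
        rwa [show k' + (t - (k' - k)) = k + t by omega,
          show x' + (t - (k' - k)) = x + t by omega] at e2
    have hb := blockPos_add_of_eq heq' (t := k' - k) (by omega)
    rw [show k + (k' - k) = k' by omega, show x + (k' - k) = x' by omega] at hb
    refine ⟨by omega, fun t ht => ?_⟩
    have hle := hu.five_mul_le_blockPos k' m
    have hd' := hu.length_le i
    rw [show k' + m = k + (k' - k + m) by omega] at hle
    exact hu.eq_of_blocks_eq (by omega) heq' (by omega) (by omega) (by omega)
  · rintro ⟨hlen, heq⟩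
    have hl := hlift (blockPos u k' + d - 2) k' h.2.2.1 (by omega)
    have hl' := hlift (blockPos u x' + d - 2) x' hx.2.2.1 (by omega)
    rw [occursAt_factorAt_iff] at hl hl'
    have heq' : ∀ t < blockPos u k' - blockPos u k + n,
        u (blockPos u k + d - 2 + t) = u (blockPos u x + d - 2 + t) := by
      intro t ht
      rcases lt_or_ge t (blockPos u k' - blockPos u k) with h1 | h1
      · exact heq t h1
      · have e1 := hl (t - (blockPos u k' - blockPos u k)) (by omega)
        have e2 := hl' (t - (blockPos u k' - blockPos u k)) (by omega)
        rw [e1] at e2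
        rwa [show blockPos u k' + d - 2 + (t - (blockPos u k' - blockPos u k)) =
            blockPos u k + d - 2 + t by omega,
          show blockPos u x' + d - 2 + (t - (blockPos u k' - blockPos u k)) =
            blockPos u x + d - 2 + t by omega] at e2
    have hik : u i = u k := hkm 0 (by omega)
    have hbm := blockPos_add_of_eq hkm' (t := m - 1) (by omega)
    obtain ⟨y, hy, hyk⟩ := hu.exists_blocks_eq (m := k' - k + m) (by omega) heq' (i := k) (d := d)
      (by omega) (by rwa [← hik]) (by omega)
      (by
        rw [show k + (k' - k + m) - 1 = k' + (m - 1) by omega]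
        rw [show i + m - 1 = i + (m - 1) by omega] at hmn
        omega)
    obtain rfl : y = x := hmono.injective (by omega)
    have hb := blockPos_add_of_eq hyk (t := k' - k) (by omega)
    rw [show k + (k' - k) = k' by omega] at hb
    have hx' : y + (k' - k) = x' := hmono.injective (by omega)
    exact ⟨by omega, fun t ht => hyk t (by omega)⟩

end Desubstitution

section ShortWords

/-- All letters of `w` belong to the alphabet `{1, 2, 3, 4}`. -/
def OverAlphabet (w : List ℕ) : Prop := ∀ a ∈ w, a ∈ [1, 2, 3, 4]

/-- The integer whose digits in base eight are the letters of `w`. -/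
def code (w : List ℕ) : ℕ := Nat.ofDigits 8 w

/-- For `x = code (s.drop k)`, `M = 8 ^ w.length` and `W = code w`, search for the first occurrence
of `w` in `s` at a position `l ≥ k` and return `8 ^ l`, where `p = 8 ^ k`. -/
def nextOccurrence (M W : ℕ) : ℕ → ℕ → ℕ → Option ℕ
  | 0, _, _ => none
  | fuel + 1, x, p =>
    bif Nat.beq (Nat.mod x M) W then some p
    else nextOccurrence M W fuel (Nat.div x 8) (Nat.mul p 8)

/-- Add an integer to a list unless it is there already. -/
def insertNat (r : ℕ) : List ℕ → List ℕ
  | [] => [r]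
  | s :: l => bif Nat.beq r s then s :: l else s :: insertNat r l

/-- The codes of the return words of `w` read off from words that begin with `w`. -/
def returnCodes (M W : ℕ) : List ℕ → Option (List ℕ)
  | [] => some []
  | s :: S =>
    match nextOccurrence M W 120 (Nat.div s 8) 8 with
    | none => none
    | some p =>
      match returnCodes M W S with
      | none => none
      | some R => some (insertNat (Nat.mod s p) R)

def hasFourReturnCodes (M W : ℕ) (S : List ℕ) : Bool :=
  match returnCodes M W S with
  | none => false
  | some R => Nat.beq R.length 4

/-- The letters which extend `w` to the right, with the words that begin with the extension. -/
def children (M W : ℕ) (S : List ℕ) : List (ℕ × List ℕ) :=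
  [1, 2, 3, 4].filterMap fun a =>
    match S.filter fun x => Nat.beq (Nat.mod x (Nat.mul 8 M)) (Nat.add W (Nat.mul a M)) with
    | [] => none
    | s :: S' => some (a, s :: S')

/-- Check that `w`, as well as its extensions to the right by at most `n` letters, has four return
words. Words with only one extension by a letter have the same return words as the extension. -/
def checkExtensions : ℕ → ℕ → ℕ → List ℕ → Bool
  | 0, M, W, S => hasFourReturnCodes M W S
  | n + 1, M, W, S =>
    match children M W S with
    | [p] => checkExtensions n (Nat.mul 8 M) (Nat.add W (Nat.mul p.1 M)) p.2
    | l => hasFourReturnCodes M W S &&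
        l.all fun p => checkExtensions n (Nat.mul 8 M) (Nat.add W (Nat.mul p.1 M)) p.2

/-- Words such that one of them occurs at each position of the fixed point. -/
def windows : List (List ℕ) :=
  quads.flatMap fun v =>
    (List.range (image (image (v.take 1))).length).map fun e => (image (image v)).drop e

set_option maxRecDepth 100000 in
theorem checkExtensions_windows : checkExtensions 12 1 0 (windows.map code) = true := by
  decide +kernel

theorem OverAlphabet.of_subset {v w : List ℕ} (hw : OverAlphabet w) (h : v ⊆ w) :
    OverAlphabet v := fun a ha => hw a (h ha)

theorem OverAlphabet.lt {w : List ℕ} (hw : OverAlphabet w) {a : ℕ} (ha : a ∈ w) : a < 8 := by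
  have := hw a ha
  simp at this
  omega

theorem OverAlphabet.ne_zero {w : List ℕ} (hw : OverAlphabet w) {a : ℕ} (ha : a ∈ w) : a ≠ 0 := by
  have := hw a ha
  simp at this
  omega

theorem code_injOn : Set.InjOn code {w | OverAlphabet w} := by
  intro v hv w hw h
  have hdigits : ∀ s, OverAlphabet s → Nat.digits 8 (code s) = s := fun s hs =>
    Nat.digits_ofDigits 8 (by norm_num) s (fun a ha => hs.lt ha)
      fun hne => hs.ne_zero (List.getLast_mem hne)
  rw [← hdigits v hv, ← hdigits w hw, h]

theorem OverAlphabet.code_mod {s : List ℕ} (hs : OverAlphabet s) (n : ℕ) :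
    code s % 8 ^ n = code (s.take n) :=
  Nat.ofDigits_mod_pow_eq_ofDigits_take n (by norm_num) s fun _ ha => hs.lt ha

theorem OverAlphabet.code_div {s : List ℕ} (hs : OverAlphabet s) :
    code s / 8 = code (s.drop 1) := by
  have := Nat.ofDigits_div_pow_eq_ofDigits_drop (p := 8) 1 (by norm_num) s fun _ ha => hs.lt ha
  simpa [code] using this

theorem code_append_singleton (w : List ℕ) (a : ℕ) :
    code (w ++ [a]) = code w + a * 8 ^ w.length := by
  simp [code, Nat.ofDigits_append, Nat.mul_comm]

theorem beq_code_iff {s w : List ℕ} (hs : OverAlphabet s) (hw : OverAlphabet w) :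
    Nat.beq (code s % 8 ^ w.length) (code w) = true ↔ w <+: s := by
  rw [Nat.beq_eq, hs.code_mod, List.prefix_iff_eq_take]
  constructor
  · intro h
    exact (code_injOn (hs.of_subset (List.take_subset _ _)) hw h).symm
  · intro h
    rw [← h]

/-- `k` is the first positive position at which `w` occurs in `s`. -/
def NextIn (w s : List ℕ) (k : ℕ) : Prop :=
  0 < k ∧ w <+: s.drop k ∧ ∀ l, 0 < l → l < k → ¬ w <+: s.drop l

theorem NextIn.unique {w s : List ℕ} {k l : ℕ} (hk : NextIn w s k) (hl : NextIn w s l) : k = l := by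
  rcases lt_trichotomy k l with h | h | h
  · exact absurd hk.2.1 (hl.2.2 k hk.1 h)
  · exact h
  · exact absurd hl.2.1 (hk.2.2 l hl.1 h)

theorem nextOccurrence_spec {s w : List ℕ} (hs : OverAlphabet s) (hw : OverAlphabet w)
    {fuel k r : ℕ}
    (h : nextOccurrence (8 ^ w.length) (code w) fuel (code (s.drop k)) (8 ^ k) = some r) :
    ∃ l ≥ k, r = 8 ^ l ∧ w <+: s.drop l ∧ ∀ i, k ≤ i → i < l → ¬ w <+: s.drop i := by
  have hd : ∀ k, OverAlphabet (s.drop k) := fun k => hs.of_subset (List.drop_subset _ _)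
  induction fuel generalizing k with
  | zero => simp [nextOccurrence] at h
  | succ fuel ih =>
    rw [nextOccurrence] at h
    by_cases hpre : w <+: s.drop k
    · have hb : Nat.beq (Nat.mod (code (s.drop k)) (8 ^ w.length)) (code w) = true :=
        (beq_code_iff (hd k) hw).2 hpre
      rw [hb, cond_true, Option.some_inj] at h
      exact ⟨k, le_rfl, h.symm, hpre, fun i h1 h2 => by omega⟩
    · have hb : Nat.beq (Nat.mod (code (s.drop k)) (8 ^ w.length)) (code w) = false :=
        Bool.eq_false_iff.2 fun hb => hpre ((beq_code_iff (hd k) hw).1 hb)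
      have hdiv : Nat.div (code (s.drop k)) 8 = code (s.drop (k + 1)) := by
        rw [← List.drop_drop]
        exact (hd k).code_div
      rw [hb, cond_false, hdiv, show Nat.mul (8 ^ k) 8 = 8 ^ (k + 1) from (pow_succ 8 k).symm] at h
      obtain ⟨l, hl, hr, hpl, hno⟩ := ih h
      refine ⟨l, by omega, hr, hpl, fun i h1 h2 => ?_⟩
      rcases Nat.eq_or_lt_of_le h1 with rfl | h1
      · exact hpre
      · exact hno i h1 h2

theorem mem_insertNat {r x : ℕ} {l : List ℕ} : x ∈ insertNat r l ↔ x = r ∨ x ∈ l := by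
  induction l with
  | nil => simp [insertNat]
  | cons s l ih =>
    rw [insertNat]
    cases h : Nat.beq r s with
    | true =>
      rw [Nat.beq_eq] at h
      subst h
      simp
    | false =>
      rw [cond_false, List.mem_cons, ih, List.mem_cons]
      tauto

theorem nodup_insertNat {r : ℕ} {l : List ℕ} (hl : l.Nodup) : (insertNat r l).Nodup := by
  induction l with
  | nil => simp [insertNat]
  | cons s l ih =>
    rw [insertNat]
    cases h : Nat.beq r s with
    | true => simpa using hl
    | false =>
      have hne : s ≠ r := by
        rintro rfl
        simp at h
      rw [List.nodup_cons] at hl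
      rw [cond_false, List.nodup_cons, mem_insertNat]
      exact ⟨by tauto, ih hl.2⟩

theorem returnCodes_spec {w : List ℕ} (hw : OverAlphabet w) {T : List (List ℕ)}
    (hT : ∀ s ∈ T, OverAlphabet s) {R : List ℕ}
    (h : returnCodes (8 ^ w.length) (code w) (T.map code) = some R) :
    R.Nodup ∧ (∀ s ∈ T, ∃ k, NextIn w s k) ∧
      ∀ x, x ∈ R ↔ ∃ s ∈ T, ∃ k, NextIn w s k ∧ x = code (s.take k) := by
  induction T generalizing R with
  | nil =>
    obtain rfl : [] = R := by simpa [returnCodes] using h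
    simp
  | cons s T ih =>
    have hs := hT s (by simp)
    rw [List.map_cons, returnCodes] at h
    split at h
    · exact absurd h (by simp)
    · rename_i p hp
      split at h
      · exact absurd h (by simp)
      · rename_i R' hR'
        obtain rfl := Option.some_inj.1 h
        obtain ⟨hnd, hex, hmem⟩ := ih (fun s hs => hT s (by simp [hs])) hR'
        rw [show Nat.div (code s) 8 = code (s.drop 1) from hs.code_div] at hp
        obtain ⟨k, hk, rfl, hpre, hno⟩ := nextOccurrence_spec (k := 1) hs hw hp
        have hnext : NextIn w s k := ⟨hk, hpre, hno⟩
        refine ⟨nodup_insertNat hnd, ?_, fun x => ?_⟩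
        · simp only [List.mem_cons, forall_eq_or_imp]
          exact ⟨⟨k, hnext⟩, hex⟩
        · rw [mem_insertNat, hmem, List.exists_mem_cons_iff,
            show Nat.mod (code s) (8 ^ k) = code (s.take k) from hs.code_mod k]
          refine or_congr_left ⟨fun hx => ⟨k, hnext, hx⟩, ?_⟩
          rintro ⟨l, hl, hx⟩
          rwa [hnext.unique hl]

theorem mem_children {M W : ℕ} {S : List ℕ} {p : ℕ × List ℕ} :
    p ∈ children M W S ↔ p.1 ∈ [1, 2, 3, 4] ∧ p.2 ≠ [] ∧
      p.2 = S.filter fun x => Nat.beq (Nat.mod x (Nat.mul 8 M)) (Nat.add W (Nat.mul p.1 M)) := by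
  obtain ⟨b, S'⟩ := p
  rw [children, List.mem_filterMap]
  constructor
  · rintro ⟨a, ha, h⟩
    split at h
    · exact absurd h (by simp)
    · rename_i s T hf
      simp only [Option.some.injEq, Prod.mk.injEq] at h
      obtain ⟨rfl, rfl⟩ := h
      exact ⟨ha, by simp, hf.symm⟩
  · rintro ⟨hb, hne, hS⟩
    refine ⟨b, hb, ?_⟩
    simp only at hS hne ⊢
    rw [← hS]
    cases S' with
    | nil => exact absurd rfl hne
    | cons s T => rfl

end ShortWords

section ShortFactors

variable {u : ℕ → ℕ}

theorem mem_windows_iff {s : List ℕ} :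
    s ∈ windows ↔ ∃ v ∈ quads, ∃ e < (image (image (v.take 1))).length,
      s = (image (image v)).drop e := by
  simp [windows, eq_comm]

theorem length_image_image_quad : ∀ v ∈ quads,
    (image (image (v.take 1))).length + 13 ≤ (image (image v)).length := by
  decide +kernel

theorem thirteen_le_length_of_mem_windows {s : List ℕ} (hs : s ∈ windows) : 13 ≤ s.length := by
  obtain ⟨v, hv, e, he, rfl⟩ := mem_windows_iff.1 hs
  have := length_image_image_quad v hv
  rw [List.length_drop]
  omega

theorem overAlphabet_of_mem_windows {s : List ℕ} (hs : s ∈ windows) : OverAlphabet s := by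
  have himage : ∀ v, OverAlphabet (image v) := by
    intro v a ha
    obtain ⟨b, -, hb⟩ := List.mem_flatMap.1 ha
    unfold sigma18 at hb
    split at hb <;> simp at hb ⊢ <;> tauto
  obtain ⟨v, -, e, -, rfl⟩ := mem_windows_iff.1 hs
  exact (himage _).of_subset (List.drop_subset _ _)

theorem IsFixedPoint.exists_window_occursAt (hu : IsFixedPoint u) (x : ℕ) :
    ∃ s ∈ windows, OccursAt u s x := by
  have hmul : ∀ n, n ≤ blockPos u n := fun n => by
    have := hu.five_mul_le_blockPos 0 n
    rw [Nat.zero_add] at this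
    omega
  obtain ⟨i, -, hle, hlt⟩ := exists_le_lt_succ (f := fun i => blockPos u (blockPos u i)) (x := x)
    (n := x + 1) (by simp [blockPos]) ((hmul _).trans (hmul _))
  obtain ⟨e, rfl⟩ := Nat.exists_eq_add_of_le hle
  have hquad := hu.quad_mem i
  have h4 := hu.occursAt_image (hu.occursAt_image (w := factorAt u i 4) (i := i)
    (by rw [OccursAt, length_factorAt])).1
  have h1 := hu.occursAt_image (w := [u i]) (i := i) (by rw [OccursAt]; rfl)
  have h2 := (hu.occursAt_image h1.1).2
  rw [← h1.2] at h2
  have he : e < (image (image ((factorAt u i 4).take 1))).length := by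
    change blockPos u (blockPos u i) + e < blockPos u (blockPos u (i + 1)) at hlt
    change blockPos u (blockPos u (i + 1)) = _ at h2
    change e < (image (image [u i])).length
    omega
  have := length_image_image_quad _ hquad
  exact ⟨_, mem_windows_iff.2 ⟨_, hquad, e, he, rfl⟩, h4.1.drop (by omega)⟩

theorem IsFixedPoint.exists_occursAt_of_mem_windows (hu : IsFixedPoint u) {s : List ℕ}
    (hs : s ∈ windows) : ∃ x, OccursAt u s x := by
  obtain ⟨v, hv, e, he, rfl⟩ := mem_windows_iff.1 hs
  have hprefix : ∀ v ∈ quads, ∃ k < 400, v <+: (image (image (image [1]))).drop k := by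
    decide +kernel
  obtain ⟨k, -, hk⟩ := hprefix v hv
  have h : OccursAt u [1] 0 := occursAt_singleton.2 hu.1
  have h3 := (hu.occursAt_image (hu.occursAt_image (hu.occursAt_image h).1).1).1
  have hk3 : k ≤ (image (image (image [1]))).length := by
    by_contra! hlt
    rw [List.drop_of_length_le hlt.le, List.prefix_nil] at hk
    subst hk
    revert hv
    decide
  have := length_image_image_quad v hv
  exact ⟨_, (hu.occursAt_image (hu.occursAt_image ((h3.drop hk3).of_prefix hk)).1).1.drop
    (by omega)⟩

theorem NextIn.successive {w s : List ℕ} {x k : ℕ} (h : NextIn w s k) (hs : OccursAt u s x)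
    (hw : w <+: s) (hlen : 0 < s.length) :
    k ≤ s.length ∧ Successive u w x (x + k) := by
  obtain ⟨hk, hpre, hno⟩ := h
  have hle : k ≤ s.length := by
    by_contra! hlt
    rw [List.drop_of_length_le hlt.le, List.prefix_nil] at hpre
    subst hpre
    exact hno 1 one_pos (by omega) List.nil_prefix
  have hocc := (hs.drop hle).of_prefix hpre
  refine ⟨hle, by omega, hs.of_prefix hw, hocc, fun l h1 h2 h3 => ?_⟩
  obtain ⟨l, rfl⟩ := Nat.exists_eq_add_of_le h1.le
  refine hno l (by omega) (by omega) (h3.prefix_of_length_le (hs.drop (by omega)) ?_)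
  have := hpre.length_le
  rw [List.length_drop] at this ⊢
  omega

theorem Successive.unique {w : List ℕ} {j k k' : ℕ} (h : Successive u w j k)
    (h' : Successive u w j k') : k = k' :=
  le_antisymm (h.eq_of_le h'.1 h'.2.2.1) (h'.eq_of_le h.1 h.2.2.1)

theorem IsFixedPoint.encard_returnWords_of_hasFourReturnCodes (hu : IsFixedPoint u) {w : List ℕ}
    (hw : OverAlphabet w) (hlen : w.length ≤ 13)
    (h : hasFourReturnCodes (8 ^ w.length) (code w)
      ((windows.filter (w.isPrefixOf ·)).map code) = true) :
    (returnWords u w).encard = 4 := by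
  have hT : ∀ s, s ∈ windows.filter (w.isPrefixOf ·) ↔ s ∈ windows ∧ w <+: s := fun s => by
    simp
  unfold hasFourReturnCodes at h
  split at h
  · exact absurd h (by simp)
  rename_i R hR
  obtain ⟨hnodup, hex, hmem⟩ := returnCodes_spec hw
    (fun s hs => overAlphabet_of_mem_windows ((hT s).1 hs).1) hR
  have hinj : Set.InjOn code (returnWords u w) := by
    refine code_injOn.mono ?_
    intro v hv a ha
    obtain ⟨j, k, -, rfl⟩ := mem_returnWords_iff.1 hv
    obtain ⟨t, -, rfl⟩ := List.mem_map.1 ha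
    exact hu.letter_mem _
  have himage : code '' returnWords u w = (R.toFinset : Set ℕ) := by
    ext x
    rw [List.coe_toFinset, Set.mem_ofPred_eq, hmem]
    constructor
    · rintro ⟨v, hv, rfl⟩
      obtain ⟨j, k, hjk, rfl⟩ := mem_returnWords_iff.1 hv
      obtain ⟨s, hs, hsj⟩ := hu.exists_window_occursAt j
      have hslen := thirteen_le_length_of_mem_windows hs
      have hws := hjk.2.1.prefix_of_length_le hsj (by omega)
      have hsT := (hT s).2 ⟨hs, hws⟩
      obtain ⟨l, hl⟩ := hex s hsT
      obtain ⟨hls, hsucc⟩ := hl.successive hsj hws (by omega)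
      obtain rfl := hjk.unique hsucc
      exact ⟨s, hsT, l, hl, by rw [Nat.add_sub_cancel_left, hsj.factorAt_eq_take hls]⟩
    · rintro ⟨s, hs, l, hl, rfl⟩
      obtain ⟨hs, hws⟩ := (hT s).1 hs
      obtain ⟨j, hsj⟩ := hu.exists_occursAt_of_mem_windows hs
      have hslen := thirteen_le_length_of_mem_windows hs
      obtain ⟨hls, hsucc⟩ := hl.successive hsj hws (by omega)
      exact ⟨_, mem_returnWords_iff.2 ⟨_, _, hsucc, rfl⟩,
        by rw [Nat.add_sub_cancel_left, hsj.factorAt_eq_take hls]⟩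
  rw [← hinj.encard_image, himage, Set.encard_coe_eq_coe_finsetCard,
    List.toFinset_card_of_nodup hnodup, Nat.beq_eq.mp h]
  rfl

theorem returnWords_congr {w w' : List ℕ} (h : ∀ j, OccursAt u w j ↔ OccursAt u w' j) :
    returnWords u w = returnWords u w' := by
  simp only [returnWords, IsReturnWord, h]

theorem filter_code_eq {w : List ℕ} (hw : OverAlphabet w) {a : ℕ} (ha : a ∈ [1, 2, 3, 4]) :
    ((windows.filter (w.isPrefixOf ·)).map code).filter (fun x =>
        Nat.beq (Nat.mod x (Nat.mul 8 (8 ^ w.length)))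
          (Nat.add (code w) (Nat.mul a (8 ^ w.length)))) =
      (windows.filter ((w ++ [a]).isPrefixOf ·)).map code := by
  have hwa : OverAlphabet (w ++ [a]) := by
    intro b hb
    rcases List.mem_append.1 hb with hb | hb
    · exact hw b hb
    · rwa [List.mem_singleton.1 hb]
  rw [List.filter_map, List.filter_filter]
  refine congrArg (List.map code) (List.filter_congr fun s hs => ?_)
  have hM : Nat.mul 8 (8 ^ w.length) = 8 ^ (w ++ [a]).length := by
    rw [List.length_append, List.length_singleton, pow_succ]
    exact Nat.mul_comm _ _
  rw [Bool.eq_iff_iff, Bool.and_eq_true, List.isPrefixOf_iff_prefix, List.isPrefixOf_iff_prefix,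
    Function.comp_apply, hM,
    show Nat.add (code w) (Nat.mul a (8 ^ w.length)) = code (w ++ [a]) from
      (code_append_singleton w a).symm]
  refine (and_congr_left' (beq_code_iff (overAlphabet_of_mem_windows hs) hwa)).trans ?_
  exact ⟨fun h => h.1, fun h => ⟨h, (List.prefix_append _ _).trans h⟩⟩

theorem IsFixedPoint.encard_returnWords_of_checkExtensions (hu : IsFixedPoint u) {n : ℕ}
    {w w' : List ℕ} (hw : OverAlphabet w) (hn : w.length + n ≤ 12) (hw' : IsFactor u w')
    (hpre : w <+: w') (hlen : w'.length ≤ w.length + n)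
    (h : checkExtensions n (8 ^ w.length) (code w)
      ((windows.filter (w.isPrefixOf ·)).map code) = true) :
    (returnWords u w').encard = 4 := by
  induction n generalizing w w' with
  | zero =>
    obtain rfl := hpre.eq_of_length_le hlen
    exact hu.encard_returnWords_of_hasFourReturnCodes hw (by omega) h
  | succ n ih =>
    set S := (windows.filter (w.isPrefixOf ·)).map code with hS
    have hchild : ∀ j, OccursAt u w j → ∃ a, OccursAt u (w ++ [a]) j ∧ a ∈ [1, 2, 3, 4] ∧
        (a, (windows.filter ((w ++ [a]).isPrefixOf ·)).map code) ∈
          children (8 ^ w.length) (code w) S := by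
      intro j hj
      have hocc : OccursAt u (w ++ [u (j + w.length)]) j :=
        occursAt_append.2 ⟨hj, occursAt_singleton.2 rfl⟩
      have ha := hu.letter_mem (j + w.length)
      refine ⟨_, hocc, ha, mem_children.2 ⟨ha, ?_, (filter_code_eq hw ha).symm⟩⟩
      obtain ⟨s, hs, hsj⟩ := hu.exists_window_occursAt j
      have hslen := thirteen_le_length_of_mem_windows hs
      have hps := hocc.prefix_of_length_le hsj (by simp; omega)
      exact List.ne_nil_of_mem (List.mem_map_of_mem
        (List.mem_filter.2 ⟨hs, List.isPrefixOf_iff_prefix.2 hps⟩))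
    have hstep : ∀ a v, a ∈ [1, 2, 3, 4] → IsFactor u v → w ++ [a] <+: v →
        v.length ≤ w.length + (n + 1) →
        checkExtensions n (Nat.mul 8 (8 ^ w.length))
          (Nat.add (code w) (Nat.mul a (8 ^ w.length)))
          ((windows.filter ((w ++ [a]).isPrefixOf ·)).map code) = true →
        (returnWords u v).encard = 4 := by
      intro a v ha hv hav hvlen hc
      refine ih (w := w ++ [a]) ?_ (by simp; omega) hv hav (by simp; omega) ?_
      · intro b hb
        rcases List.mem_append.1 hb with hb | hb
        · exact hw b hb
        · rwa [List.mem_singleton.1 hb]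
      · rw [List.length_append, List.length_singleton, pow_succ, Nat.mul_comm (8 ^ w.length),
          code_append_singleton]
        exact hc
    obtain ⟨j, hj⟩ := hw'
    have hj' := hj.of_prefix hpre
    rw [checkExtensions] at h
    split at h
    · rename_i p hp
      have hall : ∀ i, OccursAt u w i → OccursAt u (w ++ [p.1]) i ∧ p.1 ∈ [1, 2, 3, 4] ∧
          p.2 = (windows.filter ((w ++ [p.1]).isPrefixOf ·)).map code := by
        intro i hi
        obtain ⟨a, h1, h2, h3⟩ := hchild i hi
        rw [hp, List.mem_singleton] at h3
        subst h3
        exact ⟨h1, h2, rfl⟩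
      obtain ⟨hpj, hp1, hp2⟩ := hall j hj'
      rw [hp2] at h
      rcases Nat.eq_or_lt_of_le hpre.length_le with heq | hlt
      · obtain rfl := hpre.eq_of_length heq
        rw [returnWords_congr (w' := w ++ [p.1]) fun i =>
          ⟨fun hi => (hall i hi).1, fun hi => hi.of_prefix (List.prefix_append _ _)⟩]
        exact hstep _ _ hp1 ⟨j, hpj⟩ List.prefix_rfl (by simp) h
      · exact hstep _ _ hp1 ⟨j, hj⟩ (hpj.prefix_of_length_le hj (by simp; omega)) hlen h
    · rw [Bool.and_eq_true, List.all_eq_true] at h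
      rcases Nat.eq_or_lt_of_le hpre.length_le with heq | hlt
      · obtain rfl := hpre.eq_of_length heq
        exact hu.encard_returnWords_of_hasFourReturnCodes hw (by omega) h.1
      · obtain ⟨a, h1, h2, h3⟩ := hchild j hj'
        exact hstep _ _ h2 ⟨j, hj⟩ (h1.prefix_of_length_le hj (by simp; omega)) hlen (h.2 _ h3)

theorem IsFixedPoint.encard_returnWords_factorAt (hu : IsFixedPoint u) (n j : ℕ) :
    (returnWords u (factorAt u j n)).encard = 4 := by
  induction n using Nat.strong_induction_on generalizing j with
  | _ n ih =>
    rcases Nat.lt_or_ge n 13 with hn | hn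
    · refine hu.encard_returnWords_of_checkExtensions (n := 12) (w := [])
        (fun a ha => by simp at ha)
        (by simp) ⟨j, by rw [OccursAt, length_factorAt]⟩ List.nil_prefix
        (by rw [length_factorAt]; simp; omega) ?_
      have hfilter : windows.filter (([] : List ℕ).isPrefixOf ·) = windows := by simp
      rw [hfilter]
      exact checkExtensions_windows
    · obtain ⟨i, m, d, hm, hmn, hj, hd, h1, h2⟩ := hu.exists_desubstitution j hn
      rw [← hu.encard_returnWords_eq_of_desubstitution hn hm hj hd h1 h2]
      exact ih m hmn i

end ShortFactors

/-- The fixed point `u = σ^∞(1)` of the substitution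
`σ : 1 ↦ 13231, 2 ↦ 13231424131, 3 ↦ 42324131424, 4 ↦ 42324` satisfies property
`R_4`: every factor of `u` has exactly four return words.
(`u` is characterized by beginning with `1` and being fixed by `σ`: the image under
`σ` of every prefix of `u` is again a prefix of `u`.) -/
theorem fixedPoint_sigma18_propertyR_four (u : ℕ → ℕ) (hu0 : u 0 = 1)
    (hfix : ∀ k : ℕ, OccursAt u ((factorAt u 0 k).flatMap sigma18) 0) :
    PropertyR u 4 := by
  intro w ⟨j, hj⟩
  have h : (returnWords u w).encard = 4 := by
    rw [← hj]
    exact IsFixedPoint.encard_returnWords_factorAt ⟨hu0, hfix⟩ _ _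
  exact ⟨Set.finite_of_encard_eq_coe (k := 4) h, by rw [Set.ncard, h]; rfl⟩
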